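/- Let X be a connected topological space, f : X → ℝ nonnegative and bounded, X_n ⊆ X a finite subset, 𝒞̂ a cluster tree on X_n with height function f restricted to X_n, and δ > 0. Suppose: (i) for every λ and every connected component A of {f ≥ λ}, the set A ∩ X_n is connected at level λ − δ in (X_n, 𝒞̂, f); and (ii) for every λ and any two disjoint connected components B, B' of {f ≥ λ}, the sets B ∩ X_n and B' ∩ X_n are separated at level μ + δ in (X_n, 𝒞̂, f), where μ := inf_{b ∈ B, b' ∈ B'} m_f(b, b'). Then for all x, x' ∈ X_n, |m_𝒞̂(x, x') − m_f(x, x')| ≤ δ, i.e., the merge distortion between (X_n, 𝒞̂, f) and the density cluster tree of f with respect to the identity correspondence is at most δ. -/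

import Mathlib

open Set

/-- Height of a cluster: infimum of the height function over the cluster. -/
noncomputable def clusterHeight {X : Type*} (h : X → ℝ) (C : Set X) : ℝ :=
  sInf (h '' C)

/-- Points `x` and `x'` are connected at level `lam` in the cluster tree `𝒞`
equipped with height function `h`. -/
def connectedAtLevel {X : Type*} (𝒞 : Set (Set X)) (h : X → ℝ) (lam : ℝ) (x x' : X) : Prop :=
  ∃ C ∈ 𝒞, x ∈ C ∧ x' ∈ C ∧ lam ≤ clusterHeight h C

/-- A set `S` is connected at level `lam`: every pair of its points is. -/
def setConnectedAtLevel {X : Type*} (𝒞 : Set (Set X)) (h : X → ℝ) (lam : ℝ) (S : Set X) : Prop :=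
  ∀ x ∈ S, ∀ x' ∈ S, connectedAtLevel 𝒞 h lam x x'

/-- Sets `S` and `S'` are separated at level `lam`. -/
def separatedAtLevel {X : Type*} (𝒞 : Set (Set X)) (h : X → ℝ) (lam : ℝ) (S S' : Set X) : Prop :=
  ∀ s ∈ S, ∀ s' ∈ S', ¬ connectedAtLevel 𝒞 h lam s s'

/-- Merge height of two points in a cluster tree equipped with a height function. -/
noncomputable def treeMergeHeight {X : Type*} (𝒞 : Set (Set X)) (h : X → ℝ) (x x' : X) : ℝ :=
  sSup {r | ∃ C ∈ 𝒞, x ∈ C ∧ x' ∈ C ∧ r = clusterHeight h C}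

/-- `𝒞` is a cluster tree on the set `Y`: `Y ∈ 𝒞`, all clusters are subsets of `Y`,
and any two clusters are nested or disjoint (laminar family). -/
def IsClusterTreeOn {X : Type*} (Y : Set X) (𝒞 : Set (Set X)) : Prop :=
  Y ∈ 𝒞 ∧ (∀ C ∈ 𝒞, C ⊆ Y) ∧ ∀ C ∈ 𝒞, ∀ C' ∈ 𝒞, C ∩ C' = ∅ ∨ C ⊆ C' ∨ C' ⊆ C

/-- `A` is a connected component of the superlevel set `{y | lam ≤ f y}`. -/
def IsCCOfSuplevel {X : Type*} [TopologicalSpace X] (f : X → ℝ) (lam : ℝ) (A : Set X) : Prop :=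
  ∃ x, lam ≤ f x ∧ A = connectedComponentIn {y | lam ≤ f y} x

/-- Merge height of two points in the density cluster tree of `f`. -/
noncomputable def densityMergeHeight {X : Type*} [TopologicalSpace X] (f : X → ℝ)
    (x x' : X) : ℝ :=
  sSup {lam | x' ∈ connectedComponentIn {y | lam ≤ f y} x}

/-- The merge level `μ = inf_{a ∈ A, b ∈ B} m_f(a,b)` of two sets in the density
cluster tree of `f`. -/
noncomputable def densityMergeOf {X : Type*} [TopologicalSpace X] (f : X → ℝ)
    (A B : Set X) : ℝ :=
  sInf (Set.image2 (densityMergeHeight f) A B)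

theorem clusterHeight_le {X : Type*} {f : X → ℝ} {C : Set X} (hf : ∀ x, 0 ≤ f x) {x : X}
    (hx : x ∈ C) : clusterHeight f C ≤ f x :=
  csInf_le ⟨0, by rintro _ ⟨y, -, rfl⟩; exact hf y⟩ (mem_image_of_mem f hx)

theorem bddAbove_clusterHeight {X : Type*} {f : X → ℝ} (hf : ∀ x, 0 ≤ f x)
    (𝒞 : Set (Set X)) (x x' : X) :
    BddAbove {r | ∃ C ∈ 𝒞, x ∈ C ∧ x' ∈ C ∧ r = clusterHeight f C} := by
  refine ⟨f x, ?_⟩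
  rintro _ ⟨C, -, hx, -, rfl⟩
  exact clusterHeight_le hf hx

theorem bddAbove_densityMergeLevels {X : Type*} [TopologicalSpace X] (f : X → ℝ) (x x' : X) :
    BddAbove {lam | x' ∈ connectedComponentIn {y | lam ≤ f y} x} :=
  ⟨f x', fun lam hlam => connectedComponentIn_subset {y | lam ≤ f y} x hlam⟩

theorem zero_mem_densityMergeLevels {X : Type*} [TopologicalSpace X] [ConnectedSpace X]
    {f : X → ℝ} (hf : ∀ x, 0 ≤ f x) (x x' : X) :
    (0 : ℝ) ∈ {lam | x' ∈ connectedComponentIn {y | lam ≤ f y} x} := by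
  have huniv : {y | 0 ≤ f y} = univ := eq_univ_of_forall hf
  simp [huniv, connectedComponentIn_univ, PreconnectedSpace.connectedComponent_eq_univ]

theorem densityMergeHeight_nonneg {X : Type*} [TopologicalSpace X] [ConnectedSpace X]
    {f : X → ℝ} (hf : ∀ x, 0 ≤ f x) (x x' : X) : 0 ≤ densityMergeHeight f x x' :=
  le_csSup (bddAbove_densityMergeLevels f x x') (zero_mem_densityMergeLevels hf x x')

theorem densityMergeOf_le {X : Type*} [TopologicalSpace X] [ConnectedSpace X]
    {f : X → ℝ} (hf : ∀ x, 0 ≤ f x) {A B : Set X} {x x' : X} (hx : x ∈ A) (hx' : x' ∈ B) :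
    densityMergeOf f A B ≤ densityMergeHeight f x x' :=
  csInf_le ⟨0, by rintro _ ⟨a, -, b, -, rfl⟩; exact densityMergeHeight_nonneg hf a b⟩
    (mem_image2_of_mem hx hx')

/-- `δ`-minimality and `δ`-separation imply that the merge distortion between the
empirical cluster tree and the density cluster tree is at most `δ`. -/
theorem minimality_and_separation_imply_merge_distortion {X : Type*} [TopologicalSpace X]
    [ConnectedSpace X] (f : X → ℝ) (hf0 : ∀ x, 0 ≤ f x) (hfbdd : ∃ M, ∀ x, f x ≤ M)
    (Xn : Set X) (hXnfin : Xn.Finite)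
    (𝒞 : Set (Set X)) (h𝒞 : IsClusterTreeOn Xn 𝒞)
    (δ : ℝ) (hδ : 0 < δ)
    -- (i) δ-minimality
    (hmin : ∀ lam : ℝ, ∀ A : Set X, IsCCOfSuplevel f lam A →
      setConnectedAtLevel 𝒞 f (lam - δ) (A ∩ Xn))
    -- (ii) δ-separation
    (hsep : ∀ lam : ℝ, ∀ B B' : Set X,
      IsCCOfSuplevel f lam B → IsCCOfSuplevel f lam B' → B ∩ B' = ∅ →
      separatedAtLevel 𝒞 f (densityMergeOf f B B' + δ) (B ∩ Xn) (B' ∩ Xn)) :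
    ∀ x ∈ Xn, ∀ x' ∈ Xn,
      |treeMergeHeight 𝒞 f x x' - densityMergeHeight f x x'| ≤ δ := by
  intro x hx x' hx'
  rw [abs_le]
  constructor
  · suffices densityMergeHeight f x x' ≤ treeMergeHeight 𝒞 f x x' + δ by linarith
    refine csSup_le ⟨0, zero_mem_densityMergeLevels hf0 x x'⟩ fun lam hlam => ?_
    have hxlam : lam ≤ f x := connectedComponentIn_nonempty_iff (F := {y | lam ≤ f y}).1 ⟨x', hlam⟩
    obtain ⟨C, hC, hxC, hxC', hle⟩ := hmin lam _ ⟨x, hxlam, rfl⟩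
      x ⟨mem_connectedComponentIn hxlam, hx⟩ x' ⟨hlam, hx'⟩
    have hCle : clusterHeight f C ≤ treeMergeHeight 𝒞 f x x' :=
      le_csSup (bddAbove_clusterHeight hf0 𝒞 x x') ⟨C, hC, hxC, hxC', rfl⟩
    linarith
  · suffices treeMergeHeight 𝒞 f x x' ≤ densityMergeHeight f x x' + δ by linarith
    refine csSup_le ⟨_, Xn, h𝒞.1, hx, hx', rfl⟩ ?_
    rintro _ ⟨C, hC, hxC, hxC', rfl⟩
    by_contra! hlt
    have hxr : clusterHeight f C ≤ f x := clusterHeight_le hf0 hxC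
    have hxr' : clusterHeight f C ≤ f x' := clusterHeight_le hf0 hxC'
    have hmem := mem_connectedComponentIn (F := {y | clusterHeight f C ≤ f y}) hxr
    have hmem' := mem_connectedComponentIn (F := {y | clusterHeight f C ≤ f y}) hxr'
    have hμ := densityMergeOf_le hf0 hmem hmem'
    refine hsep _ _ _ ⟨x, hxr, rfl⟩ ⟨x', hxr', rfl⟩ ?_ x ⟨hmem, hx⟩ x' ⟨hmem', hx'⟩
      ⟨C, hC, hxC, hxC', by linarith⟩
    rw [eq_empty_iff_forall_notMem]
    rintro y ⟨hy, hy'⟩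
    rw [connectedComponentIn_eq hy', ← connectedComponentIn_eq hy] at hmem'
    have := le_csSup (bddAbove_densityMergeLevels f x x') hmem'
    change _ ≤ densityMergeHeight f x x' at this
    linarith
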